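/- arXiv:2006.05924 — 2 statements merged into one kernel-verified Lean document; each statement's English description precedes it below -/
import Mathlib

section
/- (Deterministic convergence lemma used in the proof of Theorem 1.) Let Ψ : ℝⁿ → ℝ be differentiable with L-Lipschitz gradient. Let (θ_k)_{k≥0} be a sequence in ℝⁿ and (α_k)_{k≥0} positive step sizes such that Σ_{k=0}^∞ α_k = ∞, Σ_{k=0}^∞ α_k‖∇Ψ(θ_k)‖₂² < ∞, and Σ_{k=0}^∞ α_k⁻¹‖θ_{k+1} − θ_k‖₂² < ∞. Then lim_{k→∞} ∇Ψ(θ_k) = 0. -/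
open Filter

/-- If `∑ α = ∞`, `∑ α g² < ∞`, `∑ α⁻¹ d² < ∞` and `g` decreases by at most `L * d k` in
step `k`, then the nonnegative sequence `g` tends to zero. -/
theorem tendsto_zero_of_summable_mul_sq {L : ℝ} (hL : 0 < L) {g d α : ℕ → ℝ}
    (hg : ∀ k, 0 ≤ g k) (hd : ∀ k, 0 ≤ d k) (hα : ∀ k, 0 < α k)
    (hstep : ∀ k, g k - g (k + 1) ≤ L * d k)
    (hdiv : Tendsto (fun m => ∑ k ∈ Finset.range m, α k) atTop atTop)
    (hsum1 : Summable fun k => α k * g k ^ 2)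
    (hsum2 : Summable fun k => (α k)⁻¹ * d k ^ 2) :
    Tendsto g atTop (nhds 0) := by
  have hs0 : ∀ k, 0 ≤ g k * d k := fun k => mul_nonneg (hg k) (hd k)
  have hs : Summable fun k => g k * d k := by
    refine Summable.of_nonneg_of_le hs0 (fun k => ?_) (hsum1.add hsum2)
    have hk := hα k
    have key : α k * g k ^ 2 + (α k)⁻¹ * d k ^ 2 - 2 * (g k * d k)
        = (α k)⁻¹ * (α k * g k - d k) ^ 2 := by
      field_simp
      ring
    have : 0 ≤ (α k)⁻¹ * (α k * g k - d k) ^ 2 := by positivity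
    linarith [hs0 k]
  have hα_not : ¬ Summable α := fun h =>
    not_tendsto_nhds_of_tendsto_atTop hdiv _ h.hasSum.tendsto_sum_nat
  rw [Metric.tendsto_atTop]
  intro δ hδ
  obtain ⟨ε, hε, rfl⟩ : ∃ ε, 0 < ε ∧ 2 * ε = δ := ⟨δ / 2, by positivity, by ring⟩
  have htail := (tendsto_sum_nat_add fun k => g k * d k).eventually_lt_const
    (show 0 < ε ^ 2 / L by positivity)
  obtain ⟨N, hN⟩ := eventually_atTop.1 htail
  refine ⟨N, fun k hk => ?_⟩
  rw [Real.dist_eq, sub_zero, abs_of_nonneg (hg k)]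
  by_contra! hlarge
  have htail_le : ∀ j, L / ε * ∑ i ∈ Finset.range j, g (i + k) * d (i + k) ≤ ε := by
    intro j
    have h1 : ∑ i ∈ Finset.range j, g (i + k) * d (i + k) ≤ ε ^ 2 / L :=
      (((summable_nat_add_iff k).2 hs).sum_le_tsum _ fun i _ => hs0 (i + k)).trans (hN k hk).le
    calc _ ≤ L / ε * (ε ^ 2 / L) := by gcongr
      _ = ε := by field_simp
  have hlow : ∀ j, 2 * ε - L / ε * ∑ i ∈ Finset.range j, g (i + k) * d (i + k) ≤ g (j + k) := by
    intro j
    induction j with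
    | zero => simpa using hlarge
    | succ j ih =>
      have hge : ε ≤ g (j + k) := by linarith [htail_le j]
      have hdj : L * d (j + k) ≤ L / ε * (g (j + k) * d (j + k)) := by
        calc L * d (j + k) = L / ε * (ε * d (j + k)) := by field_simp
          _ ≤ _ := by gcongr; exact hd _
      have hst := hstep (j + k)
      rw [Finset.sum_range_succ, mul_add, show j + 1 + k = j + k + 1 by ring]
      linarith
  refine hα_not ((summable_nat_add_iff k).1 ?_)
  refine Summable.of_nonneg_of_le (fun j => (hα _).le) (fun j => ?_)
    (((summable_nat_add_iff k).2 hsum1).mul_left (ε ^ 2)⁻¹)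
  have hge : ε ≤ g (j + k) := by linarith [htail_le j, hlow j]
  have hαj := hα (j + k)
  rw [inv_mul_eq_div, le_div_iff₀ (by positivity)]
  gcongr

/-- deterministic convergence lemma. If `Σ α_k = ∞`,
`Σ α_k‖∇Ψ(θ_k)‖² < ∞` and `Σ α_k⁻¹‖θ_{k+1} − θ_k‖² < ∞`, with `∇Ψ` Lipschitz, then
`∇Ψ(θ_k) → 0`. -/
theorem seng_deterministic_convergence
    (n : ℕ) (Ψ : EuclideanSpace ℝ (Fin n) → ℝ)
    (L : ℝ) (hL : 0 < L)
    (hdiff : Differentiable ℝ Ψ)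
    (hlip : ∀ x y : EuclideanSpace ℝ (Fin n), ‖gradient Ψ x - gradient Ψ y‖ ≤ L * ‖x - y‖)
    (θ : ℕ → EuclideanSpace ℝ (Fin n)) (α : ℕ → ℝ)
    (hα : ∀ k, 0 < α k)
    (hdiv : Tendsto (fun m => ∑ k ∈ Finset.range m, α k) atTop atTop)
    (hsum1 : Summable fun k => α k * ‖gradient Ψ (θ k)‖ ^ 2)
    (hsum2 : Summable fun k => (α k)⁻¹ * ‖θ (k + 1) - θ k‖ ^ 2) :
    Tendsto (fun k => gradient Ψ (θ k)) atTop (nhds 0) := by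
  rw [tendsto_zero_iff_norm_tendsto_zero]
  refine tendsto_zero_of_summable_mul_sq hL (fun k => norm_nonneg _) (fun k => norm_nonneg _) hα
    (fun k => ?_) hdiv hsum1 hsum2
  calc _ ≤ ‖gradient Ψ (θ k) - gradient Ψ (θ (k + 1))‖ := norm_sub_norm_le _ _
    _ ≤ L * ‖θ k - θ (k + 1)‖ := hlip _ _
    _ = _ := by rw [norm_sub_rev]
end

section
/- (Deterministic core of Theorem 2: global linear convergence by induction.) Let f : ℝⁿ → ℝ^N be any function, (θ_k)_{k≥0} a sequence in ℝⁿ, y ∈ ℝ^N, λ₀ > 0, α ∈ (0,1], and c ≥ 0 with c·(1 + √(1−α)) ≤ 3. Set B = ‖f(θ₀) − y‖₂ and R = 3B/√λ₀. Assume for every k ≥ 0: (i) if ‖θ_k − θ₀‖₂ ≤ R and ‖θ_{k+1} − θ₀‖₂ ≤ R, then ‖f(θ_{k+1}) − y‖₂² ≤ (1−α)·‖f(θ_k) − y‖₂²; and (ii) if ‖θ_k − θ₀‖₂ ≤ R, then ‖θ_{k+1} − θ_k‖₂ ≤ α·c·‖f(θ_k) − y‖₂/√λ₀. Then for every k ≥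 0 it holds that ‖θ_k − θ₀‖₂ ≤ R and ‖f(θ_k) − y‖₂² ≤ (1−α)^k · B². -/
/-- deterministic core of Theorem 2 — global linear convergence by
induction. Under the per-step contraction (i) and step-length bound (ii), every
iterate stays in the ball of radius `R = 3B/√λ₀` and residuals decay geometrically. -/
theorem seng_ntk_global_linear_convergence
    (n N : ℕ) (f : EuclideanSpace ℝ (Fin n) → EuclideanSpace ℝ (Fin N))
    (θ : ℕ → EuclideanSpace ℝ (Fin n)) (y : EuclideanSpace ℝ (Fin N))
    (lam₀ : ℝ) (hlam₀ : 0 < lam₀)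
    (α : ℝ) (hα0 : 0 < α) (hα1 : α ≤ 1)
    (c : ℝ) (hc : 0 ≤ c) (hc3 : c * (1 + Real.sqrt (1 - α)) ≤ 3)
    (B R : ℝ) (hB : B = ‖f (θ 0) - y‖) (hR : R = 3 * B / Real.sqrt lam₀)
    (hi : ∀ k : ℕ, ‖θ k - θ 0‖ ≤ R → ‖θ (k + 1) - θ 0‖ ≤ R →
      ‖f (θ (k + 1)) - y‖ ^ 2 ≤ (1 - α) * ‖f (θ k) - y‖ ^ 2)
    (hii : ∀ k : ℕ, ‖θ k - θ 0‖ ≤ R →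
      ‖θ (k + 1) - θ k‖ ≤ α * c * ‖f (θ k) - y‖ / Real.sqrt lam₀) :
    ∀ k : ℕ, ‖θ k - θ 0‖ ≤ R ∧ ‖f (θ k) - y‖ ^ 2 ≤ (1 - α) ^ k * B ^ 2 := by
  set s := Real.sqrt (1 - α)
  have hs0 : 0 ≤ s := Real.sqrt_nonneg _
  have hs_sq : s ^ 2 = 1 - α := Real.sq_sqrt (by linarith)
  have hs1 : s ≤ 1 := by nlinarith
  have hB0 : 0 ≤ B := hB ▸ norm_nonneg _
  have hL : 0 < Real.sqrt lam₀ := Real.sqrt_pos.2 hlam₀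
  have hD0 : 0 ≤ B / Real.sqrt lam₀ := by positivity
  have radius_le (k : ℕ) : c * (1 + s) * (1 - s ^ k) * (B / Real.sqrt lam₀) ≤ R := by
    have hk0 : 0 ≤ s ^ k := pow_nonneg hs0 k
    have hcs : 0 ≤ c * (1 + s) := by positivity
    rw [hR, mul_div_assoc]
    exact mul_le_mul_of_nonneg_right (by nlinarith) hD0
  have key (k : ℕ) : ‖θ k - θ 0‖ ≤ c * (1 + s) * (1 - s ^ k) * (B / Real.sqrt lam₀) ∧
      ‖f (θ k) - y‖ ≤ s ^ k * B := by
    induction k with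
    | zero => simp [hB]
    | succ k ih =>
      obtain ⟨hdist, hres⟩ := ih
      have hk := hdist.trans (radius_le k)
      have hstep : ‖θ (k + 1) - θ k‖ ≤ α * c * (s ^ k * B) / Real.sqrt lam₀ :=
        (hii k hk).trans (by gcongr)
      have hdist' : ‖θ (k + 1) - θ 0‖ ≤
          c * (1 + s) * (1 - s ^ (k + 1)) * (B / Real.sqrt lam₀) := by
        calc ‖θ (k + 1) - θ 0‖ ≤ ‖θ (k + 1) - θ k‖ + ‖θ k - θ 0‖ :=
              norm_sub_le_norm_sub_add_norm_sub _ _ _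
          _ ≤ α * c * (s ^ k * B) / Real.sqrt lam₀ +
              c * (1 + s) * (1 - s ^ k) * (B / Real.sqrt lam₀) := add_le_add hstep hdist
          _ = c * (1 + s) * (1 - s ^ (k + 1)) * (B / Real.sqrt lam₀) := by
            rw [show α = 1 - s ^ 2 by linarith]
            ring
      refine ⟨hdist', ?_⟩
      have hcontr := hi k hk (hdist'.trans (radius_le (k + 1)))
      refine (sq_le_sq₀ (norm_nonneg _) (by positivity)).1 ?_
      calc ‖f (θ (k + 1)) - y‖ ^ 2 ≤ s ^ 2 * ‖f (θ k) - y‖ ^ 2 := hs_sq ▸ hcontr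
        _ ≤ s ^ 2 * (s ^ k * B) ^ 2 := by gcongr
        _ = (s ^ (k + 1) * B) ^ 2 := by ring
  intro k
  obtain ⟨hdist, hres⟩ := key k
  refine ⟨hdist.trans (radius_le k), ?_⟩
  calc ‖f (θ k) - y‖ ^ 2 ≤ (s ^ k * B) ^ 2 := by gcongr
    _ = (1 - α) ^ k * B ^ 2 := by rw [← hs_sq]; ring
end
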